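/- arXiv:2010.06513 — 6 statements merged into one kernel-verified Lean document; each statement's English description precedes it below -/
import Mathlib

section
/- Let V be a ℂ-vector space, s ≥ 1, and let L(u) = Σ_{k=0}^s u^{s−k} L^{(k)} with L^{(0)} = Id and entries in End(V) satisfy the RLL relation for the fundamental R-matrix, and let v₀ ∈ V be a highest weight vector with weight functions λ_a. Then for each i = 1,…,m−1 and all u ∈ ℂ: λ_i(u)·λ_{−i}(u−β+i) = λ_{i+1}(u)·λ_{−i−1}(u−β+i). Moreover, in the so(2m+1) case (ε = +1, n = 2m+1) additionally λ_0(u)·λ_0(u+1/2) = λ_m(u)·λ_{−m}(u+1/2) for all u. -/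
noncomputable section

/-- The index set `I = {-m,…,-1,(0),1,…,m}` (the value `0` is included iff `zero = true`). -/
def Idx (m : ℤ) (zero : Bool) : Finset ℤ :=
  if zero then Finset.Icc (-m) m else (Finset.Icc (-m) m).erase 0

/-- The dimension `n` of the fundamental representation: `2m` or `2m+1`. -/
def nDim (m : ℤ) (zero : Bool) : ℤ := if zero then 2 * m + 1 else 2 * m

/-- `β = n/2 - ε`. -/
def betaC (m : ℤ) (zero : Bool) (sgn : ℂ) : ℂ := (nDim m zero : ℂ) / 2 - sgn

/-- The metric `ε_{ab} = ε_a δ_{a,-b}` with `ε_i = 1` for `i ≥ 0`, `ε_{-i} = ε`. -/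
def met (sgn : ℂ) (a b : ℤ) : ℂ :=
  if a = -b then (if 0 ≤ a then 1 else sgn) else 0

/-- The inverse metric `ε^{ab}`, satisfying `Σ_c ε_{ac} ε^{cb} = δ_a^b`. -/
def metUp (sgn : ℂ) (a b : ℤ) : ℂ :=
  if a = -b then (if 0 ≤ b then 1 else sgn) else 0

/-- The fundamental R-matrix
`R(u)^{a₁a₂}_{b₁b₂} = u(u+β) δ^{a₁}_{b₁} δ^{a₂}_{b₂} + (u+β) δ^{a₁}_{b₂} δ^{a₂}_{b₁}
  - ε u ε^{a₁a₂} ε_{b₁b₂}`. -/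
def Rmat (m : ℤ) (zero : Bool) (sgn : ℂ) (u : ℂ) (a1 a2 b1 b2 : ℤ) : ℂ :=
  u * (u + betaC m zero sgn) * (if a1 = b1 then 1 else 0) * (if a2 = b2 then 1 else 0)
    + (u + betaC m zero sgn) * (if a1 = b2 then 1 else 0) * (if a2 = b1 then 1 else 0)
    - sgn * u * metUp sgn a1 a2 * met sgn b1 b2

/-- The RLL relation for a matrix-valued function `L` with entries in a `ℂ`-algebra `A`. -/
def RLL (m : ℤ) (zero : Bool) (sgn : ℂ) {A : Type*} [Ring A] [Algebra ℂ A]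
    (L : ℂ → ℤ → ℤ → A) : Prop :=
  ∀ u v : ℂ, ∀ a1 ∈ Idx m zero, ∀ a2 ∈ Idx m zero, ∀ c1 ∈ Idx m zero, ∀ c2 ∈ Idx m zero,
    (∑ b1 ∈ Idx m zero, ∑ b2 ∈ Idx m zero,
      Rmat m zero sgn (u - v) a1 a2 b1 b2 • (L u b1 c1 * L v b2 c2))
    = ∑ b1 ∈ Idx m zero, ∑ b2 ∈ Idx m zero,
      Rmat m zero sgn (u - v) b1 b2 c1 c2 • (L v a2 b2 * L u a1 b1)

/-- Lowered-index entries `L_{ab}(u) = Σ_c ε_{ac} L^c_b(u)`. -/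
def Llow (m : ℤ) (zero : Bool) (sgn : ℂ) {A : Type*} [Ring A] [Algebra ℂ A]
    (L : ℂ → ℤ → ℤ → A) (u : ℂ) (a b : ℤ) : A :=
  ∑ c ∈ Idx m zero, met sgn a c • L u c b

/-- Lowered-index entries of a single matrix: `M_{ab} = Σ_c ε_{ac} M^c_b`. -/
def lowMat (m : ℤ) (zero : Bool) (sgn : ℂ) {A : Type*} [Ring A] [Algebra ℂ A]
    (M : ℤ → ℤ → A) (a b : ℤ) : A :=
  ∑ c ∈ Idx m zero, met sgn a c • M c b

/-- The entries of `L(u)` are polynomial in the spectral parameter `u`. -/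
def IsPolyFam {A : Type*} [Ring A] [Algebra ℂ A] (L : ℂ → ℤ → ℤ → A) : Prop :=
  ∃ (N : ℕ) (coef : ℕ → ℤ → ℤ → A), ∀ (u : ℂ) (a b : ℤ),
    L u a b = ∑ k ∈ Finset.range (N + 1), u ^ k • coef k a b

lemma mem_Idx_of_pos {m : ℤ} {zero : Bool} {a : ℤ} (h1 : 1 ≤ a) (h2 : a ≤ m) :
    a ∈ Idx m zero := by
  unfold Idx
  split_ifs <;> simp <;> omega

lemma neg_mem_Idx {m : ℤ} {zero : Bool} {a : ℤ} (h : a ∈ Idx m zero) :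
    -a ∈ Idx m zero := by
  unfold Idx at h ⊢
  split_ifs at h ⊢ <;> simp at h ⊢ <;> omega

lemma zero_mem_Idx {m : ℤ} (hm : 1 ≤ m) : (0 : ℤ) ∈ Idx m true := by
  simp [Idx]; omega

/-- A sum over the index set whose terms vanish off the positive indices. -/
lemma sum_Idx_eq_sum_pos {M : Type*} [AddCommMonoid M] {m : ℤ} {zero : Bool} {f : ℤ → M}
    (hneg : ∀ j, 1 ≤ j → j ≤ m → f (-j) = 0) (hz : zero = true → f 0 = 0) :
    ∑ b ∈ Idx m zero, f b = ∑ b ∈ Finset.Icc 1 m, f b := by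
  symm
  apply Finset.sum_subset
  · intro b hb
    rw [Finset.mem_Icc] at hb
    exact mem_Idx_of_pos hb.1 hb.2
  · intro b hb hb'
    rw [Finset.mem_Icc] at hb'
    rcases lt_trichotomy b 0 with h | h | h
    · have hb2 : -m ≤ b := by
        unfold Idx at hb
        split_ifs at hb <;> simp at hb <;> omega
      simpa using hneg (-b) (by omega) (by omega)
    · subst h
      apply hz
      by_contra hc
      simp [Idx, hc] at hb
    · exfalso
      unfold Idx at hb
      split_ifs at hb <;> simp at hb <;> omega

lemma met_eq_zero {sgn : ℂ} {a b : ℤ} (h : b ≠ -a) : met sgn a b = 0 := by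
  rw [met, if_neg]; omega

lemma metUp_eq_zero {sgn : ℂ} {a b : ℤ} (h : b ≠ -a) : metUp sgn a b = 0 := by
  rw [metUp, if_neg]; omega

lemma met_neg_self {sgn : ℂ} {a : ℤ} (h : 0 ≤ a) : met sgn a (-a) = 1 := by
  simp [met, h]

lemma metUp_neg_self {sgn : ℂ} {a : ℤ} (h : 0 < a) : metUp sgn a (-a) = sgn := by
  simp [metUp, h]

lemma sum_met_smul {M : Type*} [AddCommGroup M] [Module ℂ M] {m : ℤ} {sgn : ℂ} {f : ℤ → M} :
    ∑ l ∈ Finset.Icc 1 m, met sgn l (-l) • f l = ∑ l ∈ Finset.Icc 1 m, f l := by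
  refine Finset.sum_congr rfl fun l hl => ?_
  rw [Finset.mem_Icc] at hl
  rw [met_neg_self (by omega), one_smul]

lemma sum_metUp_smul {M : Type*} [AddCommGroup M] [Module ℂ M] {m : ℤ} {sgn : ℂ} {f : ℤ → M} :
    ∑ l ∈ Finset.Icc 1 m, metUp sgn l (-l) • f l = sgn • ∑ l ∈ Finset.Icc 1 m, f l := by
  rw [Finset.smul_sum]
  refine Finset.sum_congr rfl fun l hl => ?_
  rw [Finset.mem_Icc] at hl
  rw [metUp_neg_self (by omega)]

lemma Llow_eq {m : ℤ} {zero : Bool} {sgn : ℂ} {A : Type*} [Ring A] [Algebra ℂ A]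
    (L : ℂ → ℤ → ℤ → A) (u : ℂ) {a : ℤ} (b : ℤ) (ha : a ∈ Idx m zero) :
    Llow m zero sgn L u a b = met sgn a (-a) • L u (-a) b := by
  rw [Llow, Finset.sum_eq_single (-a)]
  · intro c _ hc
    rw [met_eq_zero hc, zero_smul]
  · intro h
    exact absurd (neg_mem_Idx ha) h

/-- The RLL relation with the sums over Kronecker deltas carried out, applied to a vector. -/
lemma RLL.apply {m : ℤ} {zero : Bool} {sgn : ℂ} {V : Type*} [AddCommGroup V] [Module ℂ V]
    {L : ℂ → ℤ → ℤ → Module.End ℂ V} (h : RLL m zero sgn L) (x y : ℂ) {a1 a2 c1 c2 : ℤ}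
    (ha1 : a1 ∈ Idx m zero) (ha2 : a2 ∈ Idx m zero) (hc1 : c1 ∈ Idx m zero)
    (hc2 : c2 ∈ Idx m zero) (v : V) :
    ((x - y) * (x - y + betaC m zero sgn)) • L x a1 c1 (L y a2 c2 v)
      + (x - y + betaC m zero sgn) • L x a2 c1 (L y a1 c2 v)
      - (sgn * (x - y) * metUp sgn a1 a2) •
        ∑ b ∈ Idx m zero, met sgn b (-b) • L x b c1 (L y (-b) c2 v)
    = ((x - y) * (x - y + betaC m zero sgn)) • L y a2 c2 (L x a1 c1 v)
      + (x - y + betaC m zero sgn) • L y a2 c1 (L x a1 c2 v)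
      - (sgn * (x - y) * met sgn c1 c2) •
        ∑ b ∈ Idx m zero, metUp sgn b (-b) • L y a2 (-b) (L x a1 b v) := by
  have key := congrArg (fun T : Module.End ℂ V => T v) (h x y a1 ha1 a2 ha2 c1 hc1 c2 hc2)
  simp only [Rmat, sub_smul, add_smul, Finset.sum_add_distrib, Finset.sum_sub_distrib,
    LinearMap.sub_apply, LinearMap.add_apply, LinearMap.sum_apply, LinearMap.smul_apply,
    Module.End.mul_apply] at key
  have hmet : ∀ b ∈ Idx m zero, ∀ (g : ℤ → V) (r : ℂ),
      ∑ b2 ∈ Idx m zero, (r * met sgn b b2) • g b2 = r • met sgn b (-b) • g (-b) := by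
    intro b hb g r
    rw [Finset.sum_eq_single (-b), mul_smul]
    · intro c _ hc
      rw [met_eq_zero hc, mul_zero, zero_smul]
    · intro hn
      exact absurd (neg_mem_Idx hb) hn
  have hmetUp : ∀ b ∈ Idx m zero, ∀ (g : ℤ → V) (r t : ℂ),
      ∑ b2 ∈ Idx m zero, (r * metUp sgn b b2 * t) • g b2
        = (r * t) • metUp sgn b (-b) • g (-b) := by
    intro b hb g r t
    rw [Finset.sum_eq_single (-b), smul_smul]
    · congr 1; ring
    · intro c _ hc
      rw [metUp_eq_zero hc, mul_zero, zero_mul, zero_smul]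
    · intro hn
      exact absurd (neg_mem_Idx hb) hn
  rw [Finset.sum_congr rfl fun b hb => hmet b hb _ _,
    Finset.sum_congr rfl fun b hb => hmetUp b hb (fun b2 => L y a2 b2 (L x a1 b v)) _ _,
    ← Finset.smul_sum, ← Finset.smul_sum] at key
  simpa [ite_smul, ha1, ha2, hc1, hc2] using key

/-- Matrix elements of an evaluation of finite order are polynomials, nonzero on the diagonal. -/
lemma exists_polynomial_eval {V : Type*} [AddCommGroup V] [Module ℂ V] {s : ℕ}
    {Lc : ℕ → ℤ → ℤ → Module.End ℂ V} (hLc0 : ∀ a b : ℤ, Lc 0 a b = if a = b then 1 else 0)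
    {L : ℂ → ℤ → ℤ → Module.End ℂ V}
    (hL : ∀ (u : ℂ) (a b : ℤ), L u a b = ∑ k ∈ Finset.range (s + 1), u ^ (s - k) • Lc k a b)
    (a b : ℤ) (v : V) (f : Module.Dual ℂ V) :
    ∃ P : Polynomial ℂ, (∀ u, P.eval u = f (L u a b v)) ∧ (a = b → f v ≠ 0 → P ≠ 0) := by
  refine ⟨∑ k ∈ Finset.range (s + 1), Polynomial.monomial (s - k) (f (Lc k a b v)), ?_, ?_⟩
  · intro u
    simp [hL, Polynomial.eval_finsetSum, LinearMap.sum_apply, mul_comm]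
  · intro hab hf hP
    have hc := congrArg (fun P => Polynomial.coeff P s) hP
    simp only [Polynomial.finsetSum_coeff, Polynomial.coeff_monomial, Polynomial.coeff_zero] at hc
    rw [Finset.sum_eq_single 0] at hc
    · simp [hLc0, hab] at hc
      exact hf hc
    · intro k hk hk0
      rw [Finset.mem_range] at hk
      rw [if_neg]; omega
    · simp

/-- If `v` is killed by the entries `L^i_{-j}`, then on `v` the mixed products of diagonal blocks
satisfy a crossing-type exchange relation. -/
lemma exchange_pos {m : ℤ} {zero : Bool} {sgn : ℂ} (hsgn : sgn = 1 ∨ sgn = -1)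
    {V : Type*} [AddCommGroup V] [Module ℂ V]
    {L : ℂ → ℤ → ℤ → Module.End ℂ V} (hRLL : RLL m zero sgn L) {v : V}
    (hB : ∀ u : ℂ, ∀ i j : ℤ, 1 ≤ i → i ≤ m → 1 ≤ j → j ≤ m → L u i (-j) v = 0)
    (hz : zero = true → ∀ u : ℂ, ∀ i : ℤ, 1 ≤ i → i ≤ m → L u i 0 v = 0 ∧ L u 0 (-i) v = 0)
    {x y : ℂ} (hxy : x ≠ y) {k i j : ℤ} (hk1 : 1 ≤ k) (hkm : k ≤ m) (hi1 : 1 ≤ i) (him : i ≤ m)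
    (hj1 : 1 ≤ j) (hjm : j ≤ m) :
    (x - y + betaC m zero sgn) •
        (L x k i (L y (-k) (-j) v) - L y (-k) (-j) (L x k i v))
      = ∑ l ∈ Finset.Icc 1 m, L x l i (L y (-l) (-j) v)
        - if i = j then ∑ l ∈ Finset.Icc 1 m, L y (-k) (-l) (L x k l v) else 0 := by
  have hss : sgn * sgn = 1 := by rcases hsgn with rfl | rfl <;> norm_num
  have h := hRLL.apply x y (mem_Idx_of_pos hk1 hkm) (neg_mem_Idx (mem_Idx_of_pos hk1 hkm))
    (mem_Idx_of_pos hi1 him) (neg_mem_Idx (mem_Idx_of_pos hj1 hjm)) v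
  rw [hB y k j hk1 hkm hj1 hjm, hB x k j hk1 hkm hj1 hjm] at h
  rw [sum_Idx_eq_sum_pos (fun l hl hlm => by simp [hB y l j hl hlm hj1 hjm])
      (fun h0 => by simp [(hz h0 y j hj1 hjm).2]),
    sum_Idx_eq_sum_pos (fun l hl hlm => by simp [hB x k l hk1 hkm hl hlm])
      (fun h0 => by simp [(hz h0 x k hk1 hkm).1]),
    sum_met_smul (f := fun l => L x l i (L y (-l) (-j) v)),
    sum_metUp_smul (f := fun l => L y (-k) (-l) (L x k l v)), metUp_neg_self (by omega)] at h
  have hw : x - y ≠ 0 := sub_ne_zero.mpr hxy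
  apply smul_right_injective V hw
  simp only [map_zero, smul_zero, add_zero] at h
  have e1 : sgn * (x - y) * sgn = x - y := by linear_combination (x - y) * hss
  simp only
  rw [smul_smul, smul_sub, smul_sub]
  split_ifs with hij
  · subst hij
    rw [met_neg_self (by omega), mul_one, smul_smul, e1] at h
    linear_combination (norm := module) h
  · rw [met_eq_zero (by omega), e1] at h
    simp only [mul_zero, zero_smul, sub_zero, smul_zero] at h ⊢
    linear_combination (norm := module) h

/-- A vector killed by the entries `L^i_{-j}` and by the strictly lower triangular entries of the
negative block is killed by the strictly lower triangular entries of the positive block. -/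
lemma apply_lower_eq_zero {m : ℤ} {zero : Bool} {sgn : ℂ} (hsgn : sgn = 1 ∨ sgn = -1)
    {V : Type*} [AddCommGroup V] [Module ℂ V] {s : ℕ}
    {Lc : ℕ → ℤ → ℤ → Module.End ℂ V} (hLc0 : ∀ a b : ℤ, Lc 0 a b = if a = b then 1 else 0)
    {L : ℂ → ℤ → ℤ → Module.End ℂ V}
    (hL : ∀ (u : ℂ) (a b : ℤ), L u a b = ∑ k ∈ Finset.range (s + 1), u ^ (s - k) • Lc k a b)
    (hRLL : RLL m zero sgn L) {v : V} (hv : v ≠ 0)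
    (hB : ∀ u : ℂ, ∀ i j : ℤ, 1 ≤ i → i ≤ m → 1 ≤ j → j ≤ m → L u i (-j) v = 0)
    (hz : zero = true → ∀ u : ℂ, ∀ i : ℤ, 1 ≤ i → i ≤ m → L u i 0 v = 0 ∧ L u 0 (-i) v = 0)
    (hD : ∀ u : ℂ, ∀ i j : ℤ, 1 ≤ j → j < i → i ≤ m → L u (-j) (-i) v = 0)
    {mu : ℤ → ℂ → ℂ}
    (hmu : ∀ u : ℂ, ∀ i : ℤ, 1 ≤ i → i ≤ m → L u (-i) (-i) v = mu i u • v)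
    (k i : ℤ) (hi : 1 ≤ i) (hik : i < k) (hkm : k ≤ m) (x : ℂ) : L x k i v = 0 := by
  obtain ⟨d, hd⟩ : ∃ d : ℕ, m - k = d := ⟨(m - k).toNat, by omega⟩
  induction d using Nat.strong_induction_on generalizing k i x with
  | _ d ih =>
  have hIH : ∀ l, k < l → l ≤ m → ∀ x, L x l i v = 0 := fun l hl hlm x =>
    ih (m - l).toNat (by omega) l i hi (by omega) hlm x (by omega)
  set p : ℂ := ((m - k : ℤ) : ℂ) with hp
  have hpb : p - betaC m zero sgn ≠ 0 := by
    have h2 : ((2 * k : ℤ) : ℂ) ≠ ((2 * m - nDim m zero + (if sgn = 1 then 2 else -2) : ℤ) : ℂ) := by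
      rw [Ne, Int.cast_inj]
      unfold nDim
      split_ifs <;> omega
    intro h0
    apply h2
    rw [hp, betaC] at h0
    push_cast at h0 ⊢
    rcases hsgn with rfl | rfl
    · rw [if_pos rfl]; linear_combination (-2) * h0
    · rw [if_neg (by norm_num)]; linear_combination (-2) * h0
  have hW : ∀ y : ℂ, mu k y • L (y + (p - betaC m zero sgn)) k i v = 0 := by
    intro y
    set z := y + (p - betaC m zero sgn) with hzd
    have hzy : z ≠ y := by
      intro h; apply hpb; linear_combination h
    have hc : z - y + betaC m zero sgn = p := by rw [hzd]; ring
    set S := ∑ l ∈ Finset.Icc 1 m, L z l i (L y (-l) (-k) v) with hS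
    have hex : ∀ l, 1 ≤ l → l ≤ m → p •
        (L z l i (L y (-l) (-k) v) - L y (-l) (-k) (L z l i v)) = S := by
      intro l hl hlm
      have := exchange_pos hsgn hRLL hB hz hzy hl hlm hi (by omega) (show 1 ≤ k by omega) hkm
      rw [if_neg (by omega), hc, sub_zero] at this
      exact this
    have hsplit : S = L z k i (L y (-k) (-k) v)
        + ∑ l ∈ Finset.Ioc k m, L z l i (L y (-l) (-k) v) := by
      rw [← Finset.sum_insert (f := fun l => L z l i (L y (-l) (-k) v)) (by simp),
        Finset.Ioc_insert_left hkm, hS]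
      symm
      apply Finset.sum_subset (Finset.Icc_subset_Icc_left (by omega))
      intro l hl hl'
      simp only [Finset.mem_Icc] at hl hl'
      rw [hD y k l hl.1 (by omega) hkm, map_zero]
    have htail : p • ∑ l ∈ Finset.Ioc k m, L z l i (L y (-l) (-k) v) = p • S := by
      rw [Finset.smul_sum, Finset.sum_congr rfl (g := fun _ => S), Finset.sum_const, Int.card_Ioc,
        hp, hd, Int.toNat_natCast, Int.cast_natCast, Nat.cast_smul_eq_nsmul]
      intro l hl
      rw [Finset.mem_Ioc] at hl
      rw [← hex l (by omega) hl.2, hIH l hl.1 hl.2 z, map_zero, sub_zero]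
    rw [← map_smul, ← hmu y k (by omega) hkm]
    by_cases hp0 : p = 0
    · have hmk : m = k := by
        rw [hp, Int.cast_eq_zero] at hp0; omega
      have hS0 : S = 0 := by
        rw [← hex k (by omega) hkm, hp0, zero_smul]
      rw [hS0, hmk, Finset.Ioc_self, Finset.sum_empty, add_zero] at hsplit
      exact hsplit.symm
    · apply (smul_eq_zero_iff_right hp0).mp
      have h2 := congrArg (fun t => p • t) hsplit
      simp only [smul_add, htail] at h2
      exact left_eq_add.mp (h2.trans (add_comm _ _))
  obtain ⟨f₀, hf₀⟩ := Module.Projective.exists_dual_eq_one ℂ hv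
  obtain ⟨P, hP, hP0⟩ := exists_polynomial_eval hLc0 hL (-k) (-k) v f₀
  rw [← Module.forall_dual_apply_eq_zero_iff ℂ]
  intro f
  obtain ⟨Q, hQ, -⟩ := exists_polynomial_eval hLc0 hL k i v f
  have hPQ : P * Q.comp (Polynomial.X + Polynomial.C (p - betaC m zero sgn)) = 0 := by
    apply Polynomial.funext
    intro y
    have h2 := congrArg f (hW y)
    rw [map_smul, map_zero, smul_eq_mul] at h2
    simp [hP, hQ, hmu y k (by omega) hkm, hf₀] at h2 ⊢
    exact h2
  have hQ0 := (mul_eq_zero.mp hPQ).resolve_left (hP0 rfl (by simp [hf₀]))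
  have h3 := congrArg (Polynomial.eval (x - (p - betaC m zero sgn))) hQ0
  simpa [hQ] using h3

/-- The highest weight conditions in terms of upper-index entries, with diagonal eigenvalues
`nu i` of `L^i_i` and `mu i` of `L^{-i}_{-i}` for `i > 0`. -/
structure IsHighestWeight (m : ℤ) (zero : Bool) {V : Type*} [AddCommGroup V] [Module ℂ V]
    (L : ℂ → ℤ → ℤ → Module.End ℂ V) (v : V) (nu mu : ℤ → ℂ → ℂ) : Prop where
  ne_zero : v ≠ 0
  upper : ∀ u : ℂ, ∀ i j : ℤ, 1 ≤ i → i < j → j ≤ m → L u i j v = 0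
  mixed : ∀ u : ℂ, ∀ i j : ℤ, 1 ≤ i → i ≤ m → 1 ≤ j → j ≤ m → L u i (-j) v = 0
  diag_pos : ∀ u : ℂ, ∀ i : ℤ, 1 ≤ i → i ≤ m → L u i i v = nu i u • v
  neg_block : ∀ u : ℂ, ∀ i j : ℤ, 1 ≤ j → j < i → i ≤ m → L u (-j) (-i) v = 0
  diag_neg : ∀ u : ℂ, ∀ i : ℤ, 1 ≤ i → i ≤ m → L u (-i) (-i) v = mu i u • v
  middle : zero = true → ∀ u : ℂ, ∀ i : ℤ, 1 ≤ i → i ≤ m → L u i 0 v = 0 ∧ L u 0 (-i) v = 0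

/-- On a highest weight vector, `∑ l, L^{-k}_{-l}(y) L^k_l(x)` acts diagonally. -/
lemma IsHighestWeight.sum_apply {m : ℤ} {zero : Bool} {sgn : ℂ} (hsgn : sgn = 1 ∨ sgn = -1)
    {V : Type*} [AddCommGroup V] [Module ℂ V] {s : ℕ}
    {Lc : ℕ → ℤ → ℤ → Module.End ℂ V} (hLc0 : ∀ a b : ℤ, Lc 0 a b = if a = b then 1 else 0)
    {L : ℂ → ℤ → ℤ → Module.End ℂ V}
    (hL : ∀ (u : ℂ) (a b : ℤ), L u a b = ∑ k ∈ Finset.range (s + 1), u ^ (s - k) • Lc k a b)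
    (hRLL : RLL m zero sgn L) {v : V} {nu mu : ℤ → ℂ → ℂ}
    (hw : IsHighestWeight m zero L v nu mu) (x y : ℂ) {k : ℤ} (hk1 : 1 ≤ k) (hkm : k ≤ m) :
    ∑ l ∈ Finset.Icc 1 m, L y (-k) (-l) (L x k l v) = (nu k x * mu k y) • v := by
  rw [Finset.sum_eq_single k]
  · rw [hw.diag_pos x k hk1 hkm, map_smul, hw.diag_neg y k hk1 hkm, smul_smul]
  · intro l hl hlk
    rw [Finset.mem_Icc] at hl
    rcases lt_or_gt_of_ne hlk with h | h
    · rw [apply_lower_eq_zero hsgn hLc0 hL hRLL hw.ne_zero hw.mixed hw.middle hw.neg_block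
        hw.diag_neg k l hl.1 h hkm, map_zero]
    · rw [hw.upper x k l hk1 h hl.2, map_zero]
  · intro h
    exact absurd (Finset.mem_Icc.mpr ⟨hk1, hkm⟩) h

lemma IsHighestWeight.continuous_diag_pos {m : ℤ} {zero : Bool}
    {V : Type*} [AddCommGroup V] [Module ℂ V] {s : ℕ}
    {Lc : ℕ → ℤ → ℤ → Module.End ℂ V} (hLc0 : ∀ a b : ℤ, Lc 0 a b = if a = b then 1 else 0)
    {L : ℂ → ℤ → ℤ → Module.End ℂ V}
    (hL : ∀ (u : ℂ) (a b : ℤ), L u a b = ∑ k ∈ Finset.range (s + 1), u ^ (s - k) • Lc k a b)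
    {v : V} {nu mu : ℤ → ℂ → ℂ} (hw : IsHighestWeight m zero L v nu mu)
    {i : ℤ} (hi : 1 ≤ i) (him : i ≤ m) : Continuous (nu i) := by
  obtain ⟨f₀, hf₀⟩ := Module.Projective.exists_dual_eq_one ℂ hw.ne_zero
  obtain ⟨P, hP, -⟩ := exists_polynomial_eval hLc0 hL i i v f₀
  have : nu i = fun u => P.eval u := by
    funext u
    simp [hP, hw.diag_pos u i hi him, hf₀]
  rw [this]
  exact P.continuous

/-- Adjacent products of diagonal eigenvalues agree, at all pairs of spectral parameters. -/
lemma IsHighestWeight.diag_mul_diag_succ {m : ℤ} {zero : Bool} {sgn : ℂ}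
    (hsgn : sgn = 1 ∨ sgn = -1) {V : Type*} [AddCommGroup V] [Module ℂ V] {s : ℕ}
    {Lc : ℕ → ℤ → ℤ → Module.End ℂ V} (hLc0 : ∀ a b : ℤ, Lc 0 a b = if a = b then 1 else 0)
    {L : ℂ → ℤ → ℤ → Module.End ℂ V}
    (hL : ∀ (u : ℂ) (a b : ℤ), L u a b = ∑ k ∈ Finset.range (s + 1), u ^ (s - k) • Lc k a b)
    (hRLL : RLL m zero sgn L) {v : V} {nu mu : ℤ → ℂ → ℂ}
    (hw : IsHighestWeight m zero L v nu mu) (x y : ℂ) {i : ℤ} (hi : 1 ≤ i) (him : i + 1 ≤ m) :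
    nu i x * mu i y = nu (i + 1) x * mu (i + 1) y := by
  have hgen : ∀ x, x ≠ y → nu i x * mu i y = nu (i + 1) x * mu (i + 1) y := by
    intro x hxy
    have h1 := exchange_pos hsgn hRLL hw.mixed hw.middle hxy (k := i) (i := i + 1) (j := i + 1)
      hi (by omega) (by omega) him (by omega) him
    have h2 := exchange_pos hsgn hRLL hw.mixed hw.middle hxy (k := i + 1) (i := i + 1)
      (j := i + 1) (by omega) him (by omega) him (by omega) him
    rw [if_pos rfl, hw.sum_apply hsgn hLc0 hL hRLL x y hi (by omega),
      hw.neg_block y (i + 1) i hi (by omega) him, hw.upper x i (i + 1) hi (by omega) him,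
      map_zero, map_zero, sub_zero, smul_zero] at h1
    rw [if_pos rfl, hw.sum_apply hsgn hLc0 hL hRLL x y (by omega) him,
      hw.diag_neg y (i + 1) (by omega) him, map_smul, hw.diag_pos x (i + 1) (by omega) him,
      map_smul, hw.diag_neg y (i + 1) (by omega) him, smul_comm (mu (i + 1) y), sub_self,
      smul_zero] at h2
    exact smul_left_injective ℂ hw.ne_zero
      ((sub_eq_zero.mp h1.symm).symm.trans (sub_eq_zero.mp h2.symm))
  have hc1 := hw.continuous_diag_pos hLc0 hL hi (by omega)
  have hc2 := hw.continuous_diag_pos hLc0 hL (i := i + 1) (by omega) him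
  exact congrFun (Continuous.ext_on (dense_compl_singleton y) (hc1.mul continuous_const)
    (hc2.mul continuous_const) fun x hx => hgen x hx) x

lemma IsHighestWeight.diag_mul_diag_eq_last {m : ℤ} {zero : Bool} {sgn : ℂ}
    (hsgn : sgn = 1 ∨ sgn = -1) {V : Type*} [AddCommGroup V] [Module ℂ V] {s : ℕ}
    {Lc : ℕ → ℤ → ℤ → Module.End ℂ V} (hLc0 : ∀ a b : ℤ, Lc 0 a b = if a = b then 1 else 0)
    {L : ℂ → ℤ → ℤ → Module.End ℂ V}
    (hL : ∀ (u : ℂ) (a b : ℤ), L u a b = ∑ k ∈ Finset.range (s + 1), u ^ (s - k) • Lc k a b)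
    (hRLL : RLL m zero sgn L) {v : V} {nu mu : ℤ → ℂ → ℂ}
    (hw : IsHighestWeight m zero L v nu mu) (x y : ℂ) {i : ℤ} (hi : 1 ≤ i) (him : i ≤ m) :
    nu i x * mu i y = nu m x * mu m y := by
  induction i, him using Int.leInductionDown with
  | base => rfl
  | pred n hn ih =>
    rw [← ih (by omega)]
    have := hw.diag_mul_diag_succ hsgn hLc0 hL hRLL x y hi (by omega)
    rwa [sub_add_cancel] at this

/-- The relation between the middle eigenvalue and the last pair in the odd orthogonal case. -/
lemma IsHighestWeight.zero_mul_zero {m : ℤ} (hm : 1 ≤ m)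
    {V : Type*} [AddCommGroup V] [Module ℂ V] {s : ℕ}
    {Lc : ℕ → ℤ → ℤ → Module.End ℂ V} (hLc0 : ∀ a b : ℤ, Lc 0 a b = if a = b then 1 else 0)
    {L : ℂ → ℤ → ℤ → Module.End ℂ V}
    (hL : ∀ (u : ℂ) (a b : ℤ), L u a b = ∑ k ∈ Finset.range (s + 1), u ^ (s - k) • Lc k a b)
    (hRLL : RLL m true 1 L) {v : V} {nu mu : ℤ → ℂ → ℂ}
    (hw : IsHighestWeight m true L v nu mu) {xi : ℂ → ℂ} (h0 : ∀ u, L u 0 0 v = xi u • v)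
    (y : ℂ) : xi (y + 1 / 2) * xi y = nu m (y + 1 / 2) * mu m y := by
  set x := y + 1 / 2 with hx
  have hxy : x - y = 1 / 2 := by rw [hx]; ring
  have hb : (1 / 2 : ℂ) + betaC m true 1 = m := by
    simp [betaC, nDim]; ring
  have hmid : ∀ u : ℂ, ∀ i : ℤ, 1 ≤ i → i ≤ m → L u i 0 v = 0 :=
    fun u i hi him => (hw.middle rfl u i hi him).1
  set S := ∑ b ∈ Idx m true, met 1 b (-b) • L x b 0 (L y (-b) 0 v) with hS
  have hex : ∀ k, 1 ≤ k → k ≤ m →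
      (m : ℂ) • L x k 0 (L y (-k) 0 v) = S - (nu m x * mu m y) • v := by
    intro k hk hkm
    have h := hRLL.apply x y (mem_Idx_of_pos hk hkm) (neg_mem_Idx (mem_Idx_of_pos hk hkm))
      (zero_mem_Idx hm) (zero_mem_Idx hm) v
    rw [← hS, hxy, hb, hmid x k hk hkm, hmid y k hk hkm,
      sum_Idx_eq_sum_pos (fun l hl hlm => by simp [hw.mixed x k l hk hkm hl hlm])
        (fun _ => by simp [hmid x k hk hkm]),
      sum_metUp_smul (f := fun l => L y (-k) (-l) (L x k l v)), one_smul,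
      hw.sum_apply (Or.inl rfl) hLc0 hL hRLL x y hk hkm,
      hw.diag_mul_diag_eq_last (Or.inl rfl) hLc0 hL hRLL x y hk hkm,
      metUp_neg_self (by omega), show met 1 0 0 = 1 by simp [met]] at h
    simp only [map_zero] at h
    linear_combination (norm := module) (2 : ℂ) • h
  have hsplit : S = (xi x * xi y) • v + ∑ k ∈ Finset.Icc 1 m, L x k 0 (L y (-k) 0 v) := by
    have hz : met 1 0 (-0) • L x 0 0 (L y (-0) 0 v) = (xi x * xi y) • v := by
      simp [met, h0, smul_smul, mul_comm]
    rw [hS, ← Finset.add_sum_erase _ _ (zero_mem_Idx hm), hz]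
    congr 1
    rw [show (Idx m true).erase 0 = Idx m false by simp [Idx],
      sum_Idx_eq_sum_pos (fun l hl hlm => by simp [hmid y l hl hlm]) (by simp),
      sum_met_smul (f := fun l => L x l 0 (L y (-l) 0 v))]
  have hsum : (m : ℂ) • ∑ k ∈ Finset.Icc 1 m, L x k 0 (L y (-k) 0 v)
      = (m : ℂ) • (S - (nu m x * mu m y) • v) := by
    obtain ⟨d, rfl⟩ : ∃ d : ℕ, m = d := ⟨m.toNat, by omega⟩
    have hconst : ∀ k ∈ Finset.Icc 1 (d : ℤ), ((d : ℤ) : ℂ) • L x k 0 (L y (-k) 0 v)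
        = S - (nu d x * mu d y) • v := fun k hk =>
      hex k (Finset.mem_Icc.mp hk).1 (Finset.mem_Icc.mp hk).2
    rw [Finset.smul_sum, Finset.sum_congr rfl hconst, Finset.sum_const, Int.card_Icc,
      add_sub_cancel_right, Int.toNat_natCast, Int.cast_natCast, Nat.cast_smul_eq_nsmul]
  have hm0 : (m : ℂ) ≠ 0 := by
    rw [Ne, Int.cast_eq_zero]; omega
  have hcancel := smul_right_injective V hm0 hsum
  apply smul_left_injective ℂ hw.ne_zero
  simp only
  linear_combination (norm := module) -hsplit - hcancel

/-- weight-function relations for a general order-`s` evaluation. -/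
theorem stmt9 (m : ℤ) (zero : Bool) (sgn : ℂ) (hm : 1 ≤ m)
    (hsgn : sgn = 1 ∨ sgn = -1) (hz : zero = true → sgn = 1)
    (V : Type*) [AddCommGroup V] [Module ℂ V]
    (s : ℕ) (hs : 1 ≤ s) (Lc : ℕ → ℤ → ℤ → Module.End ℂ V)
    (hLc0 : ∀ a b : ℤ, Lc 0 a b = if a = b then 1 else 0)
    (L : ℂ → ℤ → ℤ → Module.End ℂ V)
    (hL : ∀ (u : ℂ) (a b : ℤ), L u a b = ∑ k ∈ Finset.range (s + 1), u ^ (s - k) • Lc k a b)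
    (hRLL : RLL m zero sgn L)
    (v₀ : V) (hv₀ : v₀ ≠ 0) (lam : ℤ → ℂ → ℂ)
    (hw1 : ∀ u : ℂ, ∀ i j : ℤ, 1 ≤ i → i < j → j ≤ m →
      Llow m zero sgn L u (-i) j v₀ = 0)
    (hw2 : ∀ u : ℂ, ∀ i j : ℤ, 1 ≤ i → i ≤ m → 1 ≤ j → j ≤ m →
      Llow m zero sgn L u (-i) (-j) v₀ = 0)
    (hw3 : ∀ u : ℂ, ∀ i : ℤ, 1 ≤ i → i ≤ m →
      Llow m zero sgn L u (-i) i v₀ = lam i (-u) • v₀)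
    (hw4 : ∀ u : ℂ, ∀ i j : ℤ, 1 ≤ j → j < i → i ≤ m →
      Llow m zero sgn L u j (-i) v₀ = 0)
    (hw5 : ∀ u : ℂ, ∀ i : ℤ, 1 ≤ i → i ≤ m →
      Llow m zero sgn L u i (-i) v₀ = lam (-i) (-u) • v₀)
    (hw0 : zero = true → ∀ u : ℂ,
      (∀ i : ℤ, 1 ≤ i → i ≤ m →
        Llow m zero sgn L u (-i) 0 v₀ = 0 ∧
        Llow m zero sgn L u 0 (-i) v₀ = 0) ∧
      Llow m zero sgn L u 0 0 v₀ = lam 0 (-u) • v₀) :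
    (∀ i : ℤ, 1 ≤ i → i ≤ m - 1 → ∀ u : ℂ,
      lam i u * lam (-i) (u - betaC m zero sgn + (i : ℂ))
        = lam (i + 1) u * lam (-(i + 1)) (u - betaC m zero sgn + (i : ℂ)))
    ∧ (zero = true → ∀ u : ℂ,
        lam 0 u * lam 0 (u + 1 / 2) = lam m u * lam (-m) (u + 1 / 2)) := by
  have hss : sgn * sgn = 1 := by rcases hsgn with rfl | rfl <;> norm_num
  have hlow : ∀ u : ℂ, ∀ i b : ℤ, 1 ≤ i → i ≤ m →
      L u i b v₀ = sgn • Llow m zero sgn L u (-i) b v₀ := by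
    intro u i b hi him
    rw [Llow_eq L u b (neg_mem_Idx (mem_Idx_of_pos hi him)), met, if_pos (by omega),
      if_neg (by omega), neg_neg, LinearMap.smul_apply, smul_smul, hss, one_smul]
  have hhigh : ∀ u : ℂ, ∀ i b : ℤ, 0 ≤ i → i ∈ Idx m zero →
      L u (-i) b v₀ = Llow m zero sgn L u i b v₀ := by
    intro u i b hi him
    rw [Llow_eq L u b him, met_neg_self hi, one_smul]
  have hw : IsHighestWeight m zero L v₀ (fun i u => sgn * lam i (-u))
      (fun i u => lam (-i) (-u)) :=
    { ne_zero := hv₀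
      upper := fun u i j hi hij hj => by
        rw [hlow u i j hi (by omega), hw1 u i j hi hij hj, smul_zero]
      mixed := fun u i j hi him hj hjm => by
        rw [hlow u i _ hi him, hw2 u i j hi him hj hjm, smul_zero]
      diag_pos := fun u i hi him => by
        rw [hlow u i i hi him, hw3 u i hi him, smul_smul]
      neg_block := fun u i j hj hji hi => by
        rw [hhigh u j _ (by omega) (mem_Idx_of_pos hj (by omega)), hw4 u i j hj hji hi]
      diag_neg := fun u i hi him => by
        rw [hhigh u i _ (by omega) (mem_Idx_of_pos hi him), hw5 u i hi him]
      middle := fun h0 u i hi him => by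
        have hmem : (0 : ℤ) ∈ Idx m zero := h0 ▸ zero_mem_Idx hm
        have h := (hw0 h0 u).1 i hi him
        have h2 := hhigh u 0 (-i) le_rfl hmem
        rw [neg_zero, h.2] at h2
        exact ⟨by rw [hlow u i 0 hi him, h.1, smul_zero], h2⟩ }
  refine ⟨fun i hi him u => ?_, fun h0 u => ?_⟩
  · have h := hw.diag_mul_diag_succ hsgn hLc0 hL hRLL (-u) (-(u - betaC m zero sgn + i)) hi
      (by omega)
    simp only [neg_neg] at h
    linear_combination sgn * h - (lam i u * lam (-i) (u - betaC m zero sgn + i)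
      - lam (i + 1) u * lam (-(i + 1)) (u - betaC m zero sgn + i)) * hss
  · obtain rfl := hz h0
    subst h0
    have h00 : ∀ u, L u 0 0 v₀ = lam 0 (-u) • v₀ := fun u => by
      rw [← (hw0 rfl u).2, ← hhigh u 0 0 le_rfl (zero_mem_Idx hm), neg_zero]
    have h := hw.zero_mul_zero hm hLc0 hL hRLL h00 (-(u + 1 / 2))
    have e : -(-(u + 1 / 2) + 1 / 2) = u := by ring
    simpa only [neg_neg, e, one_mul] using h
end
end

section
/- (Three-factor form of the quadratic evaluation weight conditions.) Let ε ∈ {+1,−1}, β ∈ ℂ, k ∈ ℂ, m ≥ 2, λ_1,…,λ_m ∈ ℂ, and i ∈ {1,…,m−1}. For a ∈ {i, i+1} define λ̃_{−a} := (1/2)(λ_a(λ_a − ε(β−a+1)) − ε Σ_{j=1}^{a−1} λ_j + k) and λ̃_a := ε λ̃_{−a}. Then the identity (ε(u−β+i−1)² + (u−β+i−1)λ_i + λ̃_i)·((u−1)² − ε(u−1)λ_i + λ̃_{−i}) = (ε(u−β+i−1)² + (u−β+i−1)λ_{i+1} + λ̃_{i+1})·((u−1)² − ε(u−1)λ_{i+1}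 + λ̃_{−(i+1)}) holds for all u ∈ ℂ if and only if (λ_i − λ_{i+1})·(λ_i + λ_{i+1} − 2ε(β−i))·((1/2)(λ_i² + λ_{i+1}²) − ε(β−i+1)(λ_i + λ_{i+1}) + ε λ_{i+1} + k − ε Σ_{j=1}^{i−1} λ_j + (1/2)(β−i)²) = 0. -/
/-- three-factor form of the quadratic evaluation weight conditions. -/
theorem stmt12 (e β k : ℂ) (he : e = 1 ∨ e = -1) (m : ℤ) (hm : 2 ≤ m)
    (lam : ℤ → ℂ) (i : ℤ) (hi1 : 1 ≤ i) (hi2 : i ≤ m - 1) :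
    (∀ u : ℂ,
        (e * (u - β + (i : ℂ) - 1) ^ 2 + (u - β + (i : ℂ) - 1) * lam i
            + e * ((1 / 2) * (lam i * (lam i - e * (β - (i : ℂ) + 1))
                - e * (∑ j ∈ Finset.Icc 1 (i - 1), lam j) + k)))
          * ((u - 1) ^ 2 - e * (u - 1) * lam i
            + (1 / 2) * (lam i * (lam i - e * (β - (i : ℂ) + 1))
                - e * (∑ j ∈ Finset.Icc 1 (i - 1), lam j) + k))
        = (e * (u - β + (i : ℂ) - 1) ^ 2 + (u - β + (i : ℂ) - 1) * lam (i + 1)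
            + e * ((1 / 2) * (lam (i + 1) * (lam (i + 1) - e * (β - ((i : ℂ) + 1) + 1))
                - e * (∑ j ∈ Finset.Icc 1 i, lam j) + k)))
          * ((u - 1) ^ 2 - e * (u - 1) * lam (i + 1)
            + (1 / 2) * (lam (i + 1) * (lam (i + 1) - e * (β - ((i : ℂ) + 1) + 1))
                - e * (∑ j ∈ Finset.Icc 1 i, lam j) + k)))
      ↔ (lam i - lam (i + 1)) * (lam i + lam (i + 1) - 2 * e * (β - (i : ℂ)))
          * ((1 / 2) * (lam i ^ 2 + lam (i + 1) ^ 2)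
            - e * (β - (i : ℂ) + 1) * (lam i + lam (i + 1))
            + e * lam (i + 1) + k - e * (∑ j ∈ Finset.Icc 1 (i - 1), lam j)
            + (1 / 2) * (β - (i : ℂ)) ^ 2) = 0 := by
  have hsum : ∑ j ∈ Finset.Icc 1 i, lam j = ∑ j ∈ Finset.Icc 1 (i - 1), lam j + lam i := by
    rw [← Finset.insert_Icc_sub_one_right_eq_Icc hi1, Finset.sum_insert (by simp), add_comm]
  rw [hsum]
  generalize ∑ j ∈ Finset.Icc 1 (i - 1), lam j = S
  have he0 : e / 2 ≠ 0 := by rcases he with rfl | rfl <;> norm_num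
  -- The difference of the two sides does not depend on `u`: it is `e / 2` times the product.
  refine ⟨fun h => (mul_eq_zero.mp ?_).resolve_left he0, fun h u => ?_⟩
  · rw [← sub_eq_zero.mpr (h 0)]
    rcases he with rfl | rfl <;> ring
  · rw [← sub_eq_zero, ← mul_zero (e / 2), ← h]
    rcases he with rfl | rfl <;> ring
end

section
/- (sp(2) Yangian is a gl(2) Yangian after rescaling the spectral parameter.) Let A be a unital associative ℂ-algebra and let L(u) be a 2×2 matrix-valued polynomial in u with entries in A (indices in I = {−1,1}) satisfying the RLL relation with the sp(2) fundamental R-matrix. Then L̃(u) := L(2u) satisfies the gl(2) RLL relation: for all u,v ∈ ℂ and all indices, Σ_{b₁,b₂} ((u−v) δ^{a₁}_{b₁} δ^{a₂}_{b₂} + δ^{a₁}_{b₂} δ^{a₂}_{b₁}) L̃^{b₁}_{c₁}(u) L̃^{b₂}_{c₂}(v) = Σ_{b₁,b₂} L̃^{a₂}_{b₂}(v) L̃^{a₁}_{b₁}(u) ((u−v) δ^{b₁}_{c₁} δ^{b₂}_{c₂} + δ^{b₁}_{c₂} δ^{b₂}_{c₁}). -/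
noncomputable section

/-- On the two-element index set, the metric term of the `sp(2)` R-matrix is the permutation minus
the identity, so the R-matrix is a multiple of the Yang R-matrix. -/
theorem Rmat_sp_two (w : ℂ) {a1 a2 b1 b2 : ℤ} (ha1 : a1 ∈ Idx 1 false) (ha2 : a2 ∈ Idx 1 false)
    (hb1 : b1 ∈ Idx 1 false) (hb2 : b2 ∈ Idx 1 false) :
    Rmat 1 false (-1) (2 * w) a1 a2 b1 b2 =
      (2 * (2 * w + 1)) * (w * (if a1 = b1 then (1 : ℂ) else 0) * (if a2 = b2 then 1 else 0)
        + (if a1 = b2 then 1 else 0) * (if a2 = b1 then 1 else 0)) := by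
  have hI : Idx 1 false = {-1, 1} := by decide
  simp only [hI, Finset.mem_insert, Finset.mem_singleton] at ha1 ha2 hb1 hb2
  rcases ha1 with rfl | rfl <;> rcases ha2 with rfl | rfl <;> rcases hb1 with rfl | rfl <;>
    rcases hb2 with rfl | rfl <;> norm_num [Rmat, betaC, nDim, met, metUp] <;> ring

/-- A function into a complex vector space which is continuous when tested against every linear
functional is determined by its values off a point. -/
theorem eq_of_forall_dual_continuous {V : Type*} [AddCommGroup V] [Module ℂ V] {f g : ℂ → V}
    (hf : ∀ φ : Module.Dual ℂ V, Continuous fun u => φ (f u))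
    (hg : ∀ φ : Module.Dual ℂ V, Continuous fun u => φ (g u))
    (z : ℂ) (h : ∀ u ≠ z, f u = g u) : f = g := by
  funext u
  rw [← sub_eq_zero, ← Module.forall_dual_apply_eq_zero_iff ℂ]
  intro φ
  have hφ := (hf φ).ext_on (dense_compl_singleton z) (hg φ) fun u hu => congrArg φ (h u hu)
  rw [map_sub, congrFun hφ u, sub_self]

theorem IsPolyFam.continuous_dual {A : Type*} [Ring A] [Algebra ℂ A] {L : ℂ → ℤ → ℤ → A}
    (hL : IsPolyFam L) (a b : ℤ) (φ : Module.Dual ℂ A) : Continuous fun u => φ (L u a b) := by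
  obtain ⟨N, coef, h⟩ := hL
  simp only [h, map_sum, map_smul, smul_eq_mul]
  fun_prop

/-- an `sp(2)` RLL solution gives a `gl(2)` RLL solution after rescaling
the spectral parameter, `L̃(u) = L(2u)`. -/
theorem stmt15 (A : Type*) [Ring A] [Algebra ℂ A]
    (L : ℂ → ℤ → ℤ → A) (hpoly : IsPolyFam L)
    (hRLL : RLL 1 false (-1) L) :
    ∀ u v : ℂ, ∀ a1 ∈ Idx 1 false, ∀ a2 ∈ Idx 1 false, ∀ c1 ∈ Idx 1 false, ∀ c2 ∈ Idx 1 false,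
      (∑ b1 ∈ Idx 1 false, ∑ b2 ∈ Idx 1 false,
        ((u - v) * (if a1 = b1 then (1 : ℂ) else 0) * (if a2 = b2 then 1 else 0)
            + (if a1 = b2 then 1 else 0) * (if a2 = b1 then 1 else 0))
          • (L (2 * u) b1 c1 * L (2 * v) b2 c2))
      = ∑ b1 ∈ Idx 1 false, ∑ b2 ∈ Idx 1 false,
        ((u - v) * (if b1 = c1 then (1 : ℂ) else 0) * (if b2 = c2 then 1 else 0)
            + (if b1 = c2 then 1 else 0) * (if b2 = c1 then 1 else 0))
          • (L (2 * v) a2 b2 * L (2 * u) a1 b1) := by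
  intro u v a1 ha1 a2 ha2 c1 hc1 c2 hc2
  refine congrFun (eq_of_forall_dual_continuous
    (f := fun u => ∑ b1 ∈ Idx 1 false, ∑ b2 ∈ Idx 1 false,
      ((u - v) * (if a1 = b1 then (1 : ℂ) else 0) * (if a2 = b2 then 1 else 0)
        + (if a1 = b2 then 1 else 0) * (if a2 = b1 then 1 else 0))
        • (L (2 * u) b1 c1 * L (2 * v) b2 c2))
    (g := fun u => ∑ b1 ∈ Idx 1 false, ∑ b2 ∈ Idx 1 false,
      ((u - v) * (if b1 = c1 then (1 : ℂ) else 0) * (if b2 = c2 then 1 else 0)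
        + (if b1 = c2 then 1 else 0) * (if b2 = c1 then 1 else 0))
        • (L (2 * v) a2 b2 * L (2 * u) a1 b1))
    (fun φ => ?_) (fun φ => ?_) (v - 1 / 2) fun u hu => ?_) u
  · have hc (a b a' b' : ℤ) : Continuous fun u => φ (L (2 * u) a b * L (2 * v) a' b') :=
      (hpoly.continuous_dual a b (φ ∘ₗ LinearMap.mulRight ℂ (L (2 * v) a' b'))).comp
        (continuous_const_mul 2)
    simp only [map_sum, map_smul, smul_eq_mul]
    refine continuous_finsetSum _ fun b1 _ => continuous_finsetSum _ fun b2 _ => ?_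
    exact ((((continuous_id.sub continuous_const).mul continuous_const).mul
      continuous_const).add continuous_const).mul (hc _ _ _ _)
  · have hc (a b a' b' : ℤ) : Continuous fun u => φ (L (2 * v) a' b' * L (2 * u) a b) :=
      (hpoly.continuous_dual a b (φ ∘ₗ LinearMap.mulLeft ℂ (L (2 * v) a' b'))).comp
        (continuous_const_mul 2)
    simp only [map_sum, map_smul, smul_eq_mul]
    refine continuous_finsetSum _ fun b1 _ => continuous_finsetSum _ fun b2 _ => ?_
    exact ((((continuous_id.sub continuous_const).mul continuous_const).mul
      continuous_const).add continuous_const).mul (hc _ _ _ _)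
  · have hne : (2 * (2 * (u - v) + 1) : ℂ) ≠ 0 := by
      contrapose! hu
      linear_combination hu / 4
    apply smul_right_injective A hne
    have h := hRLL (2 * u) (2 * v) a1 ha1 a2 ha2 c1 hc1 c2 hc2
    rw [← mul_sub] at h
    simp only [Finset.smul_sum, smul_smul]
    convert h using 1
    · refine Finset.sum_congr rfl fun b1 hb1 => Finset.sum_congr rfl fun b2 hb2 => ?_
      rw [Rmat_sp_two _ ha1 ha2 hb1 hb2]
    · refine Finset.sum_congr rfl fun b1 hb1 => Finset.sum_congr rfl fun b2 hb2 => ?_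
      rw [Rmat_sp_two _ hb1 hb2 hc1 hc2]
end
end

section
/- (Heisenberg-algebra construction of linear evaluation.) Let A be a unital associative ℂ-algebra, ε ∈ {+1,−1}, m ≥ 1, n = 2m, β = m − ε, ℓ ∈ ℂ, and let x^i_j, ∂^i_j ∈ A (i,j ∈ {1,…,m}) satisfy x^i_j = −ε x^j_i, ∂^i_j = −ε ∂^j_i, [x^i_j, x^k_l] = 0, [∂^i_j, ∂^k_l] = 0, and [∂^i_j, x^k_l] = δ_{jk} δ_{il}·1 − ε δ_{ik} δ_{jl}·1. Define the 2m×2m matrix M = (G^a_b)_{a,b ∈ I} by G^{i}_{j} = −(ℓ+β) δ_{ij}·1 + Σ_k ∂^i_k x^k_j, G^{i}_{−j} = ∂^i_j, G^{−i}_{j} = Σ_k x^i_k ((2ℓ+β) δ_{kj}·1 − Σ_l ∂^k_l x^l_j), G^{−i}_{−j} = ℓ δ_{ij}·1 − Σ_k x^i_k ∂^k_j (i,j = 1,…,m). Then with G_{ab} := Σ_c ε_{ac} G^c_b: (i) G_{ab} = −ε G_{ba}; (ii) the orthogonal/symplectic Lie algebra relations hold: [G_{ab}, G_{cd}] = −ε_{cb}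 G_{ad} + ε_{ad} G_{cb} + ε_{ac} G_{bd} − ε_{db} G_{ca}; (iii) M² + βM = ℓ(ℓ+β)·Id. -/
noncomputable section

/-- The block-matrix generators of the Heisenberg-algebra construction:
`G^i_j = -(ℓ+β)δ_{ij} + Σ_k ∂^i_k x^k_j`, `G^i_{-j} = ∂^i_j`,
`G^{-i}_j = Σ_k x^i_k ((2ℓ+β)δ_{kj} - Σ_l ∂^k_l x^l_j)`,
`G^{-i}_{-j} = ℓδ_{ij} - Σ_k x^i_k ∂^k_j`. -/
def GupH {A : Type*} [Ring A] [Algebra ℂ A] (m : ℤ) (β ℓ : ℂ)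
    (x p : ℤ → ℤ → A) (a b : ℤ) : A :=
  if 0 < a then
    (if 0 < b then
      (-(ℓ + β)) • (if a = b then (1 : A) else 0) + ∑ k ∈ Finset.Icc 1 m, p a k * x k b
    else
      p a (-b))
  else
    (if 0 < b then
      ∑ k ∈ Finset.Icc 1 m,
        x (-a) k * ((2 * ℓ + β) • (if k = b then (1 : A) else 0)
          - ∑ l ∈ Finset.Icc 1 m, p k l * x l b)
    else
      ℓ • (if a = b then (1 : A) else 0) - ∑ k ∈ Finset.Icc 1 m, x (-a) k * p k (-b))

section HeisenbergPair

attribute [local instance] LieRing.ofAssociativeRing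

variable {ι R A : Type*} [DecidableEq ι] [CommRing R] [Ring A] [Algebra R A]

/-- Matrices `X`, `P` whose entries are `ε`-(anti)symmetric and satisfy the canonical commutation
relations of a Heisenberg algebra. -/
structure HeisenbergPair (ε : R) (X P : Matrix ι ι A) : Prop where
  x_swap : ∀ i j, X i j = (-ε) • X j i
  p_swap : ∀ i j, P i j = (-ε) • P j i
  lie_x_x : ∀ i j k l, ⁅X i j, X k l⁆ = 0
  lie_p_p : ∀ i j k l, ⁅P i j, P k l⁆ = 0
  lie_p_x : ∀ i j k l, ⁅P i j, X k l⁆ =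
    ((if j = k then (1 : R) else 0) * (if i = l then 1 else 0)
      - ε * (if i = k then 1 else 0) * (if j = l then 1 else 0)) • (1 : A)

theorem lie_mul_right_eq (a b c : A) : ⁅a, b * c⁆ = ⁅a, b⁆ * c + b * ⁅a, c⁆ := by
  simp only [Ring.lie_def]; noncomm_ring

theorem lie_mul_left_eq (a b c : A) : ⁅a * b, c⁆ = a * ⁅b, c⁆ + ⁅a, c⁆ * b := by
  simp only [Ring.lie_def]; noncomm_ring

theorem lie_ite_scalar_left (p : Prop) [Decidable p] (r : R) (a : A) :
    ⁅(if p then r • (1 : A) else 0), a⁆ = 0 := by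
  split_ifs <;> simp [Ring.lie_def]

theorem lie_ite_scalar_right (p : Prop) [Decidable p] (r : R) (a : A) :
    ⁅a, (if p then r • (1 : A) else 0)⁆ = 0 := by
  split_ifs <;> simp [Ring.lie_def]

theorem lie_smul_right_eq (r : R) (a b : A) : ⁅a, r • b⁆ = r • ⁅a, b⁆ := by
  simp [Ring.lie_def, smul_sub]

theorem lie_smul_left_eq (r : R) (a b : A) : ⁅r • a, b⁆ = r • ⁅a, b⁆ := by
  simp [Ring.lie_def, smul_sub]

namespace HeisenbergPair

variable {ε : R} {X P : Matrix ι ι A}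

theorem lie_x_p (h : HeisenbergPair ε X P) (i j k l : ι) : ⁅X k l, P i j⁆ =
    (ε * (if i = k then 1 else 0) * (if j = l then 1 else 0)
      - (if j = k then (1 : R) else 0) * (if i = l then 1 else 0)) • (1 : A) := by
  rw [← lie_skew, h.lie_p_x, ← neg_smul, neg_sub]

theorem x_mul_p_swap (h : HeisenbergPair ε X P) (hε : ε * ε = 1) (i j k l : ι) :
    X i j * P k l = X j i * P l k := by
  rw [h.x_swap i j, h.p_swap k l, smul_mul_smul_comm, neg_mul_neg, hε, one_smul]

/-- The split metric which is symmetric for `ε = 1` and alternating for `ε = -1`. -/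
def metric (ε : R) : ι ⊕ ι → ι ⊕ ι → R
  | .inl i, .inr j => if i = j then 1 else 0
  | .inr i, .inl j => if i = j then ε else 0
  | _, _ => 0

theorem metric_swap (hε : ε * ε = 1) (a b : ι ⊕ ι) : metric ε a b = ε * metric ε b a := by
  rcases a with i | i <;> rcases b with j | j <;> simp [metric, hε, eq_comm]

/-- The Lie algebra relation between the lowered generators `g a b` and `g c d`. -/
def LieRelation (ε : R) (g : ι ⊕ ι → ι ⊕ ι → A) (a b c d : ι ⊕ ι) : Prop :=
  ⁅g a b, g c d⁆ = -(metric ε c b • g a d) + metric ε a d • g c b + metric ε a c • g b d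
    - metric ε d b • g c a

theorem LieRelation.swap_left {g : ι ⊕ ι → ι ⊕ ι → A} (hε : ε * ε = 1)
    (hg : ∀ a b, g a b = (-ε) • g b a) {a b c d : ι ⊕ ι} (hr : LieRelation ε g a b c d) :
    LieRelation ε g b a c d := by
  unfold LieRelation at *
  rw [hg b a, lie_smul_left_eq, hr, metric_swap hε c a, metric_swap hε b d, metric_swap hε b c,
    metric_swap hε d a]
  module

theorem LieRelation.swap_pairs {g : ι ⊕ ι → ι ⊕ ι → A} (hε : ε * ε = 1)
    (hg : ∀ a b, g a b = (-ε) • g b a) {a b c d : ι ⊕ ι} (hr : LieRelation ε g a b c d) :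
    LieRelation ε g c d a b := by
  unfold LieRelation at *
  have hm (a b c d : ι ⊕ ι) : metric ε c a • g d b = -(metric ε a c • g b d) := by
    rw [metric_swap hε c a, hg d b]
    linear_combination (norm := module) -(hε • (metric ε a c • g b d))
  rw [← lie_skew, hr, hm a b c d, hm d c b a]
  module

theorem LieRelation.swap_right {g : ι ⊕ ι → ι ⊕ ι → A} (hε : ε * ε = 1)
    (hg : ∀ a b, g a b = (-ε) • g b a) {a b c d : ι ⊕ ι} (hr : LieRelation ε g a b c d) :
    LieRelation ε g a b d c :=
  ((hr.swap_pairs hε hg).swap_left hε hg).swap_pairs hε hg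

variable [Fintype ι]

theorem lie_xp_x (h : HeisenbergPair ε X P) (i j k l : ι) : ⁅(X * P) i j, X k l⁆ =
    (if j = k then (1 : R) else 0) • X i l - (ε * if j = l then 1 else 0) • X i k := by
  simp [Matrix.mul_apply, sum_lie, lie_mul_left_eq, h.lie_p_x, h.lie_x_x, sub_smul,
    mul_sub, Finset.sum_sub_distrib, ite_smul]

theorem lie_xp_p (h : HeisenbergPair ε X P) (i j k l : ι) : ⁅(X * P) i j, P k l⁆ =
    (ε * if k = i then 1 else 0) • P l j - (if l = i then (1 : R) else 0) • P k j := by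
  simp [Matrix.mul_apply, sum_lie, lie_mul_left_eq, h.lie_x_p, h.lie_p_p, sub_smul,
    sub_mul, Finset.sum_sub_distrib, ite_smul]

theorem lie_xp_xp (h : HeisenbergPair ε X P) (hε : ε * ε = 1) (i j k l : ι) :
    ⁅(X * P) i j, (X * P) k l⁆ =
      (if j = k then (1 : R) else 0) • (X * P) i l
        - (if l = i then (1 : R) else 0) • (X * P) k j := by
  rw [Matrix.mul_apply (i := k), lie_sum]
  simp only [lie_mul_right_eq, h.lie_xp_x, h.lie_xp_p]
  simp [sub_mul, mul_sub, Finset.sum_add_distrib, Finset.sum_sub_distrib,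
    ← Matrix.mul_apply, h.x_mul_p_swap hε k i l j]

theorem lie_xp_xpx (h : HeisenbergPair ε X P) (hε : ε * ε = 1) (i j k l : ι) :
    ⁅(X * P) i j, (X * P * X) k l⁆ =
      (if j = k then (1 : R) else 0) • (X * P * X) i l
        + (if j = l then (1 : R) else 0) • (X * P * X) k i := by
  rw [Matrix.mul_apply (i := k), lie_sum]
  simp only [lie_mul_right_eq, h.lie_xp_x, h.lie_xp_xp hε]
  have hs (b : ι) : (X * P) k b * X i b = (-ε) • ((X * P) k b * X b i) := by
    rw [h.x_swap i b, mul_smul_comm]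
  simp [sub_mul, mul_sub, Finset.sum_add_distrib, Finset.sum_sub_distrib, ← Finset.smul_sum,
    ← Matrix.mul_apply, hs]
  split_ifs <;> simp [smul_smul, hε]

/-- Normal ordering of `P * X`. -/
theorem px_apply (h : HeisenbergPair ε X P) (hε : ε * ε = 1) (i j : ι) :
    (P * X) i j = (X * P) j i
      + (((Fintype.card ι : R) - ε) * if i = j then 1 else 0) • (1 : A) := by
  have hs (k : ι) : P i k * X k j = X j k * P k i
      + ((if i = j then (1 : R) else 0)
        - ε * (if i = k then 1 else 0) * (if k = j then 1 else 0)) • (1 : A) := by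
    have := h.lie_p_x i k k j
    rw [Ring.lie_def, sub_eq_iff_eq_add] at this
    rw [this, h.x_mul_p_swap hε k j i k]
    simp [add_comm]
  rw [Matrix.mul_apply, Matrix.mul_apply, Finset.sum_congr rfl fun k _ => hs k,
    Finset.sum_add_distrib, ← Finset.sum_smul]
  simp [Finset.sum_sub_distrib]
  split_ifs <;> simp_all

theorem xpx_swap (h : HeisenbergPair ε X P) (hε : ε * ε = 1) (i j : ι) :
    (X * P * X) i j = (-ε) • (X * P * X) j i := by
  have key (i j : ι) : (X * P * X) i j =
      (∑ k, ∑ l, X i k * X j l * P l k) + ((Fintype.card ι : R) - ε) • X i j := by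
    rw [Matrix.mul_assoc, Matrix.mul_apply]
    simp [h.px_apply hε, mul_add, Finset.sum_add_distrib]
    simp [Matrix.mul_apply, Finset.mul_sum, mul_assoc]
  have hs (k l : ι) : X i k * X j l * P l k = (-ε) • (X j l * X i k * P k l) := by
    have := h.lie_x_x i k j l
    rw [Ring.lie_def, sub_eq_zero] at this
    rw [this, h.p_swap l k, mul_smul_comm]
  rw [key, key, Finset.sum_comm, h.x_swap i j]
  simp only [hs, ← Finset.smul_sum]
  module

theorem lie_xpx_x (h : HeisenbergPair ε X P) (i j k l : ι) :
    ⁅(X * P * X) i j, X k l⁆ = X i l * X k j - ε • (X i k * X l j) := by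
  rw [Matrix.mul_apply, sum_lie]
  simp [lie_mul_left_eq, h.lie_xp_x, h.lie_x_x, sub_mul, Finset.sum_sub_distrib,
    ite_smul, mul_ite, ite_mul]

theorem lie_p_xpx (h : HeisenbergPair ε X P) (i j k l : ι) :
    ⁅P i j, (X * P * X) k l⁆ =
      (if j = k then (1 : R) else 0) • (P * X) i l
        - (ε * if i = k then (1 : R) else 0) • (P * X) j l
        + (if i = l then (1 : R) else 0) • (X * P) k j
        - (ε * if j = l then (1 : R) else 0) • (X * P) k i := by
  have hs (b : ι) : ⁅P i j, (X * P) k b⁆ =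
      (if j = k then (1 : R) else 0) • P i b - (ε * if i = k then (1 : R) else 0) • P j b := by
    rw [← lie_skew, h.lie_xp_p, neg_sub]
  rw [Matrix.mul_apply (i := k), lie_sum]
  simp only [lie_mul_right_eq, hs, h.lie_p_x]
  simp [sub_mul, mul_sub, Finset.sum_add_distrib, Finset.sum_sub_distrib, ← Finset.smul_sum,
    ← Matrix.mul_apply, sub_smul, ite_smul]
  abel

theorem lie_xpx_xpx (h : HeisenbergPair ε X P) (hε : ε * ε = 1) (i j k l : ι) :
    ⁅(X * P * X) i j, (X * P * X) k l⁆ = 0 := by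
  have hE (b : ι) : ⁅(X * P * X) i j, (X * P) k b⁆ =
      -((if b = i then (1 : R) else 0) • (X * P * X) k j
        + (if b = j then (1 : R) else 0) • (X * P * X) i k) := by
    rw [← lie_skew, h.lie_xp_xpx hε]
  have hs (b : ι) : (X * P) k b * ((X * P * X) i j * X b l - X b l * (X * P * X) i j) =
      (X * P) k b * X b j * X i l + (X * P) k b * X b i * X l j := by
    have hx := h.lie_x_x i l b j
    rw [Ring.lie_def, sub_eq_zero] at hx
    rw [← Ring.lie_def, h.lie_xpx_x, hx, h.x_swap i b, smul_mul_assoc, smul_smul, mul_neg, hε]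
    simp [mul_add, mul_assoc]
  have hk : (X * P * X) i k * X j l = (X * P * X) k i * X l j := by
    rw [h.xpx_swap hε i k, h.x_swap j l, smul_mul_smul_comm, neg_mul_neg, hε, one_smul]
  rw [Matrix.mul_apply (i := k), lie_sum]
  simp only [lie_mul_right_eq, hE, Ring.lie_def _ (X _ l), hs]
  simp [Finset.sum_add_distrib, add_mul, ← Finset.sum_mul, ← Matrix.mul_apply, hk]

/-- The lowered generators of the orthogonal or symplectic Lie algebra, with positive indices on
the left and negative ones on the right. -/
def lowered (ε ℓ : R) (X P : Matrix ι ι A) : ι ⊕ ι → ι ⊕ ι → A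
  | .inl i, .inl j => ((2 * ℓ + (Fintype.card ι - ε)) • X - X * P * X) i j
  | .inl i, .inr j => (ℓ • (1 : Matrix ι ι A) - X * P) i j
  | .inr i, .inl j => (-ε) • (ℓ • (1 : Matrix ι ι A) - X * P) j i
  | .inr i, .inr j => ε • P i j

theorem lowered_swap (h : HeisenbergPair ε X P) (hε : ε * ε = 1) (ℓ : R) (a b : ι ⊕ ι) :
    lowered ε ℓ X P a b = (-ε) • lowered ε ℓ X P b a := by
  rcases a with i | i <;> rcases b with j | j <;> simp only [lowered, smul_smul]
  · rw [Matrix.sub_apply, Matrix.sub_apply, h.xpx_swap hε i j, Matrix.smul_apply,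
      Matrix.smul_apply, h.x_swap i j]
    module
  · simp [hε]
  · rw [h.p_swap i j, smul_smul, mul_comm]

theorem lieRelation_lowered (h : HeisenbergPair ε X P) (hε : ε * ε = 1) (ℓ : R)
    (a b c d : ι ⊕ ι) : LieRelation ε (lowered ε ℓ X P) a b c d := by
  have hg := h.lowered_swap hε ℓ
  have xx (i j k l : ι) :
      LieRelation ε (lowered ε ℓ X P) (.inl i) (.inl j) (.inl k) (.inl l) := by
    unfold LieRelation
    simp only [lowered, metric, Matrix.sub_apply, Matrix.smul_apply]
    have hxx : ⁅X i j, (X * P * X) k l⁆ = ε • (X i k * X l j) - X i l * X k j := by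
      have hc := h.lie_x_x k j i l
      rw [Ring.lie_def, sub_eq_zero] at hc
      rw [← lie_skew, h.lie_xpx_x, neg_sub, hc, h.x_swap k i, h.x_swap j l, smul_mul_smul_comm,
        neg_mul_neg, hε, one_smul]
    simp [lie_smul_right_eq, h.lie_xpx_xpx hε, h.lie_xpx_x, h.lie_x_x, hxx]
  have hx (i j k l : ι) :
      LieRelation ε (lowered ε ℓ X P) (.inl i) (.inr j) (.inl k) (.inl l) := by
    unfold LieRelation
    simp only [lowered, metric, Matrix.sub_apply, Matrix.smul_apply, Matrix.one_apply]
    simp [lie_smul_right_eq, lie_ite_scalar_left, h.lie_xp_xpx hε, h.lie_xp_x, h.x_swap i k]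
    simp only [eq_comm (a := k) (b := j), eq_comm (a := l) (b := j)]
    split_ifs <;> match_scalars <;> grind
  have hh (i j k l : ι) :
      LieRelation ε (lowered ε ℓ X P) (.inl i) (.inr j) (.inl k) (.inr l) := by
    unfold LieRelation
    simp only [lowered, metric, Matrix.sub_apply, Matrix.smul_apply, Matrix.one_apply]
    simp [lie_ite_scalar_left, lie_ite_scalar_right, h.lie_xp_xp hε]
    simp only [eq_comm (a := k) (b := j), eq_comm (a := l) (b := i)]
    split_ifs <;> match_scalars <;> grind
  have hp (i j k l : ι) :
      LieRelation ε (lowered ε ℓ X P) (.inl i) (.inr j) (.inr k) (.inr l) := by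
    unfold LieRelation
    simp only [lowered, metric, Matrix.sub_apply, Matrix.smul_apply, Matrix.one_apply]
    simp [lie_smul_right_eq, lie_ite_scalar_left, h.lie_xp_p, h.p_swap l j]
    simp only [eq_comm (a := k) (b := i), eq_comm (a := l) (b := i)]
    split_ifs <;> match_scalars <;> grind
  have px (i j k l : ι) :
      LieRelation ε (lowered ε ℓ X P) (.inr i) (.inr j) (.inl k) (.inl l) := by
    unfold LieRelation
    simp only [lowered, metric, Matrix.sub_apply, Matrix.smul_apply, Matrix.one_apply]
    simp [lie_smul_right_eq, h.lie_p_xpx, h.lie_p_x, h.px_apply hε]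
    simp only [eq_comm (a := k) (b := j), eq_comm (a := l) (b := i), eq_comm (a := k) (b := i),
      eq_comm (a := l) (b := j)]
    split_ifs <;> match_scalars <;> grind
  have pp (i j k l : ι) :
      LieRelation ε (lowered ε ℓ X P) (.inr i) (.inr j) (.inr k) (.inr l) := by
    unfold LieRelation
    simp only [lowered, metric]
    simp [lie_smul_right_eq, h.lie_p_p]
  rcases a with i | i <;> rcases b with j | j <;> rcases c with k | k <;> rcases d with l | l
  · exact xx ..
  · exact (hx ..).swap_pairs hε hg
  · exact ((hx ..).swap_pairs hε hg).swap_right hε hg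
  · exact (px ..).swap_pairs hε hg
  · exact hx ..
  · exact hh ..
  · exact (hh ..).swap_right hε hg
  · exact hp ..
  · exact (hx ..).swap_left hε hg
  · exact (hh ..).swap_left hε hg
  · exact ((hh ..).swap_right hε hg).swap_left hε hg
  · exact (hp ..).swap_left hε hg
  · exact px ..
  · exact (hp ..).swap_pairs hε hg
  · exact ((hp ..).swap_pairs hε hg).swap_right hε hg
  · exact pp ..

/-- The evaluation matrix in block form, positive indices first. -/
def evaluationMatrix (β ℓ : R) (X P : Matrix ι ι A) : Matrix (ι ⊕ ι) (ι ⊕ ι) A :=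
  Matrix.fromBlocks (-(ℓ + β) • 1 + P * X) P (X * ((2 * ℓ + β) • 1 - P * X)) (ℓ • 1 - X * P)

theorem evaluationMatrix_quadratic (β ℓ : R) (X P : Matrix ι ι A) :
    evaluationMatrix β ℓ X P * evaluationMatrix β ℓ X P + β • evaluationMatrix β ℓ X P =
      (ℓ * (ℓ + β)) • 1 := by
  rw [evaluationMatrix, Matrix.fromBlocks_multiply, Matrix.fromBlocks_smul, Matrix.fromBlocks_add,
    ← Matrix.fromBlocks_one, Matrix.fromBlocks_smul]
  congr 1 <;>
  · simp only [mul_add, add_mul, mul_sub, sub_mul, smul_mul_assoc, mul_smul_comm, mul_one, one_mul,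
      smul_zero, Matrix.mul_assoc]
    module

theorem sum_metric_smul_evaluationMatrix (h : HeisenbergPair ε X P) (hε : ε * ε = 1) (ℓ : R)
    (a b : ι ⊕ ι) :
    ∑ c, metric ε a c • evaluationMatrix ((Fintype.card ι : R) - ε) ℓ X P c b =
      lowered ε ℓ X P a b := by
  rcases a with i | i <;> rcases b with j | j <;>
    simp [metric, evaluationMatrix, lowered, ite_smul, h.px_apply hε, mul_sub, ← Matrix.mul_assoc,
      Matrix.one_apply, Finset.sum_add_distrib, eq_comm (a := j) (b := i)]
  split_ifs <;> module

end HeisenbergPair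

end HeisenbergPair

section SignedIndex

variable {m : ℤ}

/-- The index set `{-m, …, -1, 1, …, m}` as two copies of `{1, …, m}`. -/
def signedIndex : Finset.Icc (1 : ℤ) m ⊕ Finset.Icc (1 : ℤ) m → ℤ :=
  Sum.elim (fun i => (i : ℤ)) (fun i => -(i : ℤ))

theorem signedIndex_injective : Function.Injective (signedIndex (m := m)) := by
  rintro (⟨i, hi⟩ | ⟨i, hi⟩) (⟨j, hj⟩ | ⟨j, hj⟩) h <;>
    simp only [signedIndex, Sum.elim_inl, Sum.elim_inr, Finset.mem_Icc] at h hi hj <;>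
    simp <;> omega

theorem image_signedIndex : Finset.univ.image (signedIndex (m := m)) = Idx m false := by
  ext a
  simp only [Idx, Finset.mem_image, Finset.mem_univ, true_and, Sum.exists, signedIndex,
    Sum.elim_inl, Sum.elim_inr, Subtype.exists, Finset.mem_Icc, Bool.false_eq_true, if_false,
    Finset.mem_erase]
  constructor
  · rintro (⟨i, hi, rfl⟩ | ⟨i, hi, rfl⟩) <;> omega
  · intro ha
    rcases lt_or_gt_of_ne ha.1 with h | h
    · exact Or.inr ⟨-a, by omega, by omega⟩
    · exact Or.inl ⟨a, by omega, rfl⟩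

theorem forall_mem_Idx_iff {p : ℤ → Prop} :
    (∀ a ∈ Idx m false, p a) ↔ ∀ s, p (signedIndex (m := m) s) := by
  simp only [← image_signedIndex, Finset.forall_mem_image, Finset.mem_univ, true_imp_iff]

theorem sum_Idx {M : Type*} [AddCommMonoid M] (f : ℤ → M) :
    ∑ c ∈ Idx m false, f c = ∑ s, f (signedIndex (m := m) s) := by
  rw [← image_signedIndex, Finset.sum_image signedIndex_injective.injOn]

theorem met_signedIndex (sgn : ℂ) (s t : Finset.Icc (1 : ℤ) m ⊕ Finset.Icc (1 : ℤ) m) :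
    met sgn (signedIndex s) (signedIndex t) = HeisenbergPair.metric sgn s t := by
  rcases s with ⟨i, hi⟩ | ⟨i, hi⟩ <;> rcases t with ⟨j, hj⟩ | ⟨j, hj⟩ <;>
    rw [Finset.mem_Icc] at hi hj <;>
    simp only [signedIndex, HeisenbergPair.metric, Sum.elim_inl, Sum.elim_inr, Subtype.mk.injEq] <;>
    simp only [met, neg_neg, neg_inj]
  · rw [if_neg (by omega)]
  · rw [if_pos (by omega : 0 ≤ i)]
  · rw [if_neg (by omega : ¬ 0 ≤ -i)]
  · rw [if_neg (by omega)]

theorem betaC_false (hm : 0 ≤ m) (sgn : ℂ) :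
    betaC m false sgn = (Fintype.card (Finset.Icc (1 : ℤ) m) : ℂ) - sgn := by
  simp [betaC, nDim, ← Int.cast_natCast (R := ℂ) m.toNat, Int.toNat_of_nonneg hm]

theorem GupH_signedIndex {A : Type*} [Ring A] [Algebra ℂ A] (β ℓ : ℂ) (x p : ℤ → ℤ → A)
    (s t : Finset.Icc (1 : ℤ) m ⊕ Finset.Icc (1 : ℤ) m) :
    GupH m β ℓ x p (signedIndex s) (signedIndex t) =
      HeisenbergPair.evaluationMatrix β ℓ (Matrix.of fun i j : Finset.Icc (1 : ℤ) m => x i j)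
        (Matrix.of fun i j : Finset.Icc (1 : ℤ) m => p i j) s t := by
  rcases s with ⟨i, hi⟩ | ⟨i, hi⟩ <;> rcases t with ⟨j, hj⟩ | ⟨j, hj⟩ <;>
    have hi' := (Finset.mem_Icc.1 hi).1 <;> have hj' := (Finset.mem_Icc.1 hj).1 <;>
    simp only [signedIndex, HeisenbergPair.evaluationMatrix, Sum.elim_inl, Sum.elim_inr,
      Matrix.fromBlocks_apply₁₁, Matrix.fromBlocks_apply₁₂, Matrix.fromBlocks_apply₂₁, Matrix.fromBlocks_apply₂₂, Matrix.add_apply, Matrix.sub_apply,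
      Matrix.smul_apply, Matrix.one_apply, Matrix.mul_apply, Matrix.of_apply, Subtype.ext_iff,
      Finset.sum_coe_sort (Finset.Icc 1 m) (fun k => x i k * p k j)] <;>
    simp only [GupH, neg_neg, neg_inj]
  · rw [if_pos (by omega), if_pos (by omega), ← Finset.sum_coe_sort]
  · rw [if_pos (by omega), if_neg (by omega)]
  · rw [if_neg (by omega), if_pos (by omega), ← Finset.sum_coe_sort]
    refine Finset.sum_congr rfl fun k _ => ?_
    rw [← Finset.sum_coe_sort (Finset.Icc 1 m) (fun l => p k l * x l j)]
  · rw [if_neg (by omega), if_neg (by omega)]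

end SignedIndex

/-- Heisenberg-algebra construction of the linear evaluation for
`so(2m)`/`sp(2m)`. -/
theorem stmt17 (m : ℤ) (sgn : ℂ) (hm : 1 ≤ m) (hsgn : sgn = 1 ∨ sgn = -1) (ℓ : ℂ)
    (A : Type*) [Ring A] [Algebra ℂ A]
    (x p : ℤ → ℤ → A)
    (hxa : ∀ i ∈ Finset.Icc 1 m, ∀ j ∈ Finset.Icc 1 m, x i j = (-sgn) • x j i)
    (hpa : ∀ i ∈ Finset.Icc 1 m, ∀ j ∈ Finset.Icc 1 m, p i j = (-sgn) • p j i)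
    (hxx : ∀ i ∈ Finset.Icc 1 m, ∀ j ∈ Finset.Icc 1 m, ∀ k ∈ Finset.Icc 1 m,
      ∀ l ∈ Finset.Icc 1 m, x i j * x k l = x k l * x i j)
    (hpp : ∀ i ∈ Finset.Icc 1 m, ∀ j ∈ Finset.Icc 1 m, ∀ k ∈ Finset.Icc 1 m,
      ∀ l ∈ Finset.Icc 1 m, p i j * p k l = p k l * p i j)
    (hpx : ∀ i ∈ Finset.Icc 1 m, ∀ j ∈ Finset.Icc 1 m, ∀ k ∈ Finset.Icc 1 m,
      ∀ l ∈ Finset.Icc 1 m,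
      p i j * x k l - x k l * p i j
        = ((if j = k then (1 : ℂ) else 0) * (if i = l then 1 else 0)
            - sgn * (if i = k then 1 else 0) * (if j = l then 1 else 0)) • (1 : A)) :
    (∀ a ∈ Idx m false, ∀ b ∈ Idx m false,
      lowMat m false sgn (GupH m (betaC m false sgn) ℓ x p) a b
        = -(sgn • lowMat m false sgn (GupH m (betaC m false sgn) ℓ x p) b a))
    ∧ (∀ a ∈ Idx m false, ∀ b ∈ Idx m false, ∀ c ∈ Idx m false, ∀ d ∈ Idx m false,
        lowMat m false sgn (GupH m (betaC m false sgn) ℓ x p) a b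
            * lowMat m false sgn (GupH m (betaC m false sgn) ℓ x p) c d
          - lowMat m false sgn (GupH m (betaC m false sgn) ℓ x p) c d
            * lowMat m false sgn (GupH m (betaC m false sgn) ℓ x p) a b
        = -(met sgn c b • lowMat m false sgn (GupH m (betaC m false sgn) ℓ x p) a d)
          + met sgn a d • lowMat m false sgn (GupH m (betaC m false sgn) ℓ x p) c b
          + met sgn a c • lowMat m false sgn (GupH m (betaC m false sgn) ℓ x p) b d
          - met sgn d b • lowMat m false sgn (GupH m (betaC m false sgn) ℓ x p) c a)
    ∧ (∀ a ∈ Idx m false, ∀ b ∈ Idx m false,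
        (∑ c ∈ Idx m false,
            GupH m (betaC m false sgn) ℓ x p a c * GupH m (betaC m false sgn) ℓ x p c b)
          + betaC m false sgn • GupH m (betaC m false sgn) ℓ x p a b
          = (ℓ * (ℓ + betaC m false sgn)) • (if a = b then (1 : A) else 0)) := by
  have hε : sgn * sgn = 1 := by rcases hsgn with rfl | rfl <;> norm_num
  have h : HeisenbergPair sgn (Matrix.of fun i j : Finset.Icc (1 : ℤ) m => x i j)
      (Matrix.of fun i j : Finset.Icc (1 : ℤ) m => p i j) :=
    { x_swap := fun i j => hxa i i.2 j j.2
      p_swap := fun i j => hpa i i.2 j j.2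
      lie_x_x := fun i j k l => sub_eq_zero.2 (hxx i i.2 j j.2 k k.2 l l.2)
      lie_p_p := fun i j k l => sub_eq_zero.2 (hpp i i.2 j j.2 k k.2 l l.2)
      lie_p_x := fun i j k l => by
        simpa only [Ring.lie_def, Matrix.of_apply, Subtype.ext_iff]
          using hpx i i.2 j j.2 k k.2 l l.2 }
  have hlow (s t) := h.sum_metric_smul_evaluationMatrix hε ℓ s t
  simp only [forall_mem_Idx_iff, lowMat, sum_Idx, met_signedIndex, GupH_signedIndex,
    betaC_false (zero_le_one.trans hm), hlow]
  refine ⟨fun s t => ?_, fun a b c d => ?_, fun s t => ?_⟩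
  · rw [h.lowered_swap hε ℓ s t, neg_smul]
  · exact h.lieRelation_lowered hε ℓ a b c d
  · simpa [Matrix.mul_apply, Matrix.one_apply, signedIndex_injective.eq_iff] using
      congrFun (congrFun (HeisenbergPair.evaluationMatrix_quadratic _ ℓ
        (Matrix.of fun i j : Finset.Icc (1 : ℤ) m => x i j)
        (Matrix.of fun i j : Finset.Icc (1 : ℤ) m => p i j)) s) t
end
end

section
/- (Jordan–Schwinger construction.) Let A be a unital associative ℂ-algebra and let x_a, ∂_a ∈ A (a ∈ I) satisfy ∂_a x_b − ε x_b ∂_a = ε_{ab}·1, x_a x_b = ε x_b x_a, and ∂_a ∂_b = ε ∂_b ∂_a for all a,b ∈ I. Define G_{ab} := −ε(x_a ∂_b − ε x_b ∂_a). Then: (i) the orthogonal/symplectic Lie algebra relations hold: [G_{ab}, G_{cd}] = −ε_{cb} G_{ad} + ε_{ad} G_{cb} + ε_{ac} G_{bd} − ε_{db} G_{ca}; and (ii) the totally symmetrized quadratic expressions vanish: W_{ab,cd} := G_{ab}G_{cd} + G_{ac}G_{db} + G_{ad}G_{bc} + G_{cd}G_{ab} + G_{db}G_{ac} + G_{bc}G_{ad}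 = 0 for all a,b,c,d ∈ I. -/
noncomputable section

theorem zero_mem_Idx_iff (m : ℤ) (zero : Bool) (hm : 1 ≤ m) :
    (0 : ℤ) ∈ Idx m zero ↔ zero = true := by
  cases zero <;> simp [Idx]
  omega

/-- On the index set the metric is `ε`-symmetric. -/
theorem met_swap {m : ℤ} {zero : Bool} {sgn : ℂ} (hm : 1 ≤ m)
    (hsgn : sgn = 1 ∨ sgn = -1) (hz : zero = true → sgn = 1) {a : ℤ}
    (ha : a ∈ Idx m zero) (b : ℤ) : met sgn b a = sgn * met sgn a b := by
  have h0 : a = 0 → sgn = 1 := by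
    rintro rfl
    exact hz ((zero_mem_Idx_iff m zero hm).1 ha)
  rcases hsgn with rfl | rfl
  · have : b = -a ↔ a = -b := by omega
    simp [met, this]
  · have ha0 : a ≠ 0 := fun h => by
      have := h0 h
      norm_num at this
    unfold met
    by_cases h : a = -b
    · have hb : b = -a := by omega
      by_cases h1 : 0 ≤ a
      · have h2 : ¬ 0 ≤ b := by omega
        rw [if_pos hb, if_pos h, if_pos h1, if_neg h2]
        ring
      · have h2 : 0 ≤ b := by omega
        rw [if_pos hb, if_pos h, if_neg h1, if_pos h2]
        ring
    · have hb : ¬ b = -a := by omega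
      simp [h, hb]

/-- Normal ordering of a product of two bilinears `x ∂`. -/
theorem mul_mul_normal_order {A : Type*} [Ring A] [Algebra ℂ A] {s g : ℂ} {y q : A}
    (h : q * y - s • (y * q) = g • (1 : A)) (z r : A) :
    z * q * (y * r) = s • (z * y * (q * r)) + g • (z * r) := by
  have h' : q * y = s • (y * q) + g • (1 : A) := by
    rw [← h]
    abel
  calc z * q * (y * r) = z * (q * y) * r := by simp only [mul_assoc]
    _ = _ := by
      rw [h']
      simp only [mul_add, add_mul, mul_smul_comm, smul_mul_assoc, mul_one, mul_assoc]

/-- Jordan–Schwinger construction: Lie algebra relations and vanishing of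
the totally symmetrized quadratic expressions `W`. -/
theorem stmt18 (m : ℤ) (zero : Bool) (sgn : ℂ) (hm : 1 ≤ m)
    (hsgn : sgn = 1 ∨ sgn = -1) (hz : zero = true → sgn = 1)
    (A : Type*) [Ring A] [Algebra ℂ A]
    (x p : ℤ → A)
    (hpx : ∀ a ∈ Idx m zero, ∀ b ∈ Idx m zero,
      p a * x b - sgn • (x b * p a) = met sgn a b • (1 : A))
    (hxx : ∀ a ∈ Idx m zero, ∀ b ∈ Idx m zero, x a * x b = sgn • (x b * x a))
    (hpp : ∀ a ∈ Idx m zero, ∀ b ∈ Idx m zero, p a * p b = sgn • (p b * p a))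
    (G : ℤ → ℤ → A)
    (hG : ∀ a b : ℤ, G a b = (-sgn) • (x a * p b - sgn • (x b * p a))) :
    (∀ a ∈ Idx m zero, ∀ b ∈ Idx m zero, ∀ c ∈ Idx m zero, ∀ d ∈ Idx m zero,
      G a b * G c d - G c d * G a b
        = -(met sgn c b • G a d) + met sgn a d • G c b
          + met sgn a c • G b d - met sgn d b • G c a)
    ∧ (∀ a ∈ Idx m zero, ∀ b ∈ Idx m zero, ∀ c ∈ Idx m zero, ∀ d ∈ Idx m zero,
        G a b * G c d + G a c * G d b + G a d * G b c
          + G c d * G a b + G d b * G a c + G b c * G a d = 0) := by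
  have key : ∀ a ∈ Idx m zero, ∀ b ∈ Idx m zero, ∀ c ∈ Idx m zero, ∀ d ∈ Idx m zero,
      (x a * p b - sgn • (x b * p a)) * (x c * p d - sgn • (x d * p c)) =
        sgn • (x a * x c * (p b * p d)) + met sgn b c • (x a * p d)
        - sgn • (sgn • (x a * x d * (p b * p c)) + met sgn b d • (x a * p c))
        - sgn • (sgn • (x b * x c * (p a * p d)) + met sgn a c • (x b * p d))
        + (sgn * sgn) • (sgn • (x b * x d * (p a * p c)) + met sgn a d • (x b * p c)) := by
    intro a ha b hb c hc d hd
    rw [← mul_mul_normal_order (hpx b hb c hc), ← mul_mul_normal_order (hpx b hb d hd),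
      ← mul_mul_normal_order (hpx a ha c hc), ← mul_mul_normal_order (hpx a ha d hd)]
    simp only [mul_sub, sub_mul, mul_smul_comm, smul_mul_assoc]
    module
  refine ⟨fun a ha b hb c hc d hd => ?_, fun a ha b hb c hc d hd => ?_⟩ <;>
  · have swap : ∀ i ∈ Idx m zero, ∀ j, met sgn j i = sgn * met sgn i j :=
      fun i hi j => met_swap hm hsgn hz hi j
    simp only [hG, key a ha b hb c hc d hd, key c hc d hd a ha b hb,
      key a ha c hc d hd b hb, key d hd b hb a ha c hc, key a ha d hd b hb c hc,
      key b hb c hc a ha d hd,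
      hxx b hb a ha, hxx c hc a ha, hxx d hd a ha, hxx c hc b hb, hxx d hd b hb, hxx d hd c hc,
      hpp b hb a ha, hpp c hc a ha, hpp d hd a ha, hpp c hc b hb, hpp d hd b hb, hpp d hd c hc,
      swap a ha b, swap a ha c, swap a ha d, swap b hb c, swap b hb d, swap c hc d,
      mul_smul_comm, smul_mul_assoc]
    rcases hsgn with rfl | rfl <;> module
end
end

section
/- (Product of two linear L-operators is a quadratic evaluation.) Let A be a unital associative ℂ-algebra, n ≥ 1, β ∈ ℂ, δ ∈ ℂ, and let G₁, G₂ be n×n matrices with entries in A such that every entry of G₁ commutes with every entry of G₂ and Gᵢ² + β Gᵢ = cᵢ·Id for scalars c₁, c₂ ∈ ℂ. Set G := G₁ + G₂, H̄ := (1/2)(G₁G₂ − G₂G₁) + (δ/2)(G₁ − G₂), and k := −δ²/2 − c₁ − c₂. Then for all u ∈ ℂ: ((u − δ/2)·Id + G₁)·((u + δ/2)·Id + G₂) = u²·Id + u·G + (1/2)(G² + βG + k·Id) + H̄. -/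
/-- the product of two linear L-operators is a quadratic evaluation. -/
theorem stmt19 (n : ℕ) (hn : 1 ≤ n) (β δ c1 c2 : ℂ)
    (A : Type*) [Ring A] [Algebra ℂ A]
    (G1 G2 : Matrix (Fin n) (Fin n) A)
    (hcomm : ∀ i j k l : Fin n, G1 i j * G2 k l = G2 k l * G1 i j)
    (h1 : G1 * G1 + β • G1 = c1 • (1 : Matrix (Fin n) (Fin n) A))
    (h2 : G2 * G2 + β • G2 = c2 • (1 : Matrix (Fin n) (Fin n) A)) :
    ∀ u : ℂ,
      ((u - δ / 2) • (1 : Matrix (Fin n) (Fin n) A) + G1)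
          * ((u + δ / 2) • (1 : Matrix (Fin n) (Fin n) A) + G2)
        = (u ^ 2) • (1 : Matrix (Fin n) (Fin n) A) + u • (G1 + G2)
          + (1 / 2 : ℂ) • ((G1 + G2) * (G1 + G2) + β • (G1 + G2)
              + (-δ ^ 2 / 2 - c1 - c2) • (1 : Matrix (Fin n) (Fin n) A))
          + ((1 / 2 : ℂ) • (G1 * G2 - G2 * G1) + (δ / 2) • (G1 - G2)) := by
  intro u
  rw [← eq_sub_iff_add_eq] at h1 h2
  simp only [add_mul, mul_add, smul_mul_assoc, mul_smul_comm, one_mul, mul_one, h1, h2]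
  module
end
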